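/- arXiv:2512.18936 — 4 statements merged into one kernel-verified Lean document; each statement's English description precedes it below -/
import Mathlib

section
/- Fix σ₁ > 1/3. There exists a constant C > 0 (depending only on σ₁ and the sequence (ε_k)) such that for every prime p and every s with Re s ≥ σ₁ one has |G_p(s) − 1| ≤ C p^{−3σ₁}. -/
open Asymptotics Filter Topology

/-- A function continuous on a closed ball and `O(‖u‖ ^ n)` at the centre is bounded by a
multiple of `‖u‖ ^ n` on the whole ball. -/
theorem exists_norm_le_mul_pow_of_isBigO {f : ℂ → ℂ} {r : ℝ} {n : ℕ}
    (hf : ContinuousOn f (Metric.closedBall 0 r))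
    (hO : f =O[𝓝 0] fun u : ℂ => u ^ n) :
    ∃ C : ℝ, 0 < C ∧ ∀ u : ℂ, ‖u‖ ≤ r → ‖f u‖ ≤ C * ‖u‖ ^ n := by
  obtain ⟨A, hA, hfA⟩ := hO.exists_pos
  obtain ⟨δ, hδ, hball⟩ := Metric.eventually_nhds_iff.1 hfA.bound
  obtain ⟨M, hM⟩ := (isCompact_closedBall (0 : ℂ) r).exists_bound_of_continuousOn hf
  refine ⟨max A (M / δ ^ n), lt_max_of_lt_left hA, fun u hu => ?_⟩
  rcases lt_or_ge ‖u‖ δ with h | h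
  · calc ‖f u‖ ≤ A * ‖u ^ n‖ := hball (by simpa using h)
      _ ≤ max A (M / δ ^ n) * ‖u‖ ^ n := by
        rw [norm_pow]
        gcongr
        exact le_max_left _ _
  · have hfu : ‖f u‖ ≤ M := hM u (by simpa using hu)
    have hM0 : 0 ≤ M := (norm_nonneg _).trans hfu
    calc ‖f u‖ ≤ M / δ ^ n * δ ^ n := by rwa [div_mul_cancel₀ _ (by positivity)]
      _ ≤ max A (M / δ ^ n) * ‖u‖ ^ n := by
        gcongr
        exact le_max_right _ _

theorem one_sub_cpow_isBigO (a : ℂ) :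
    (fun u : ℂ => (1 - u) ^ a - (1 - a * u + a * (a - 1) / 2 * u ^ 2))
      =O[𝓝 0] fun u : ℂ => u ^ 3 := by
  have h := (Complex.one_add_cpow_hasFPowerSeriesAt_zero (a := a)).isBigO_sub_partialSum_pow 3
  have hneg : Tendsto (fun u : ℂ => -u) (𝓝 0) (𝓝 0) := by
    simpa using (continuous_neg.tendsto (0 : ℂ))
  refine (h.comp_tendsto hneg).congr' (.of_forall fun u => ?_) (.of_forall fun u => rfl) |>.trans
    (.of_bound 1 (.of_forall fun u => by simp))
  have h2 : Ring.choose a 2 = a * (a - 1) / 2 := by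
    rw [Ring.choose_eq_smul]
    simp [descPochhammer_succ_right, Polynomial.smeval_mul, Polynomial.smeval_sub,
      Polynomial.smeval_X, Polynomial.smeval_one]
    ring
  simp [FormalMultilinearSeries.partialSum, Finset.sum_range_succ, binomialSeries, h2,
    FormalMultilinearSeries.coeff_ofScalars, ← sub_eq_add_neg]
  ring

theorem one_sub_sq_cpow_isBigO (a : ℂ) :
    (fun u : ℂ => (1 - u ^ 2) ^ a - (1 - a * u ^ 2)) =O[𝓝 0] fun u : ℂ => u ^ 3 := by
  have hsq : Tendsto (fun u : ℂ => u ^ 2) (𝓝 0) (𝓝 0) := by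
    simpa using ((continuous_pow 2).tendsto (0 : ℂ))
  have hpow : ∀ {k : ℕ}, 3 ≤ k → (fun u : ℂ => u ^ k) =O[𝓝 0] fun u : ℂ => u ^ 3 := by
    refine fun hk => .of_bound 1 ?_
    filter_upwards [Metric.closedBall_mem_nhds (0 : ℂ) one_pos] with u hu
    simpa using pow_le_pow_of_le_one (norm_nonneg u) (mem_closedBall_zero_iff.1 hu) hk
  have h := ((one_sub_cpow_isBigO a).comp_tendsto hsq).congr_right (g₂ := fun u : ℂ => u ^ 6)
    fun u => by simp [← pow_mul]
  refine ((h.trans (hpow (by norm_num))).add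
    ((hpow (k := 4) (by norm_num)).const_mul_left (a * (a - 1) / 2))).congr_left fun u => ?_
  simp only [Function.comp_apply]
  ring

theorem continuousOn_tsum_mul_pow {c : ℕ → ℂ} (hc : ∀ k, ‖c k‖ ≤ 1) {r : ℝ} (hr : r < 1) :
    ContinuousOn (fun u : ℂ => ∑' k, c k * u ^ k) (Metric.closedBall 0 r) := by
  rcases lt_or_ge r 0 with h | h
  · simp [Metric.closedBall_eq_empty.2 h]
  refine continuousOn_tsum (u := fun k => r ^ k) (fun k => by fun_prop)
    (summable_geometric_of_lt_one h hr) fun k u hu => ?_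
  rw [mem_closedBall_zero_iff] at hu
  rw [norm_mul, norm_pow]
  exact (mul_le_of_le_one_left (by positivity) (hc k)).trans (by gcongr)

theorem tsum_mul_pow_sub_sum_isBigO {c : ℕ → ℂ} (hc : ∀ k, ‖c k‖ ≤ 1) (n : ℕ) :
    (fun u : ℂ => (∑' k, c k * u ^ k) - ∑ k ∈ Finset.range n, c k * u ^ k)
      =O[𝓝 0] fun u : ℂ => u ^ n := by
  refine .of_bound 2 ?_
  filter_upwards [Metric.closedBall_mem_nhds (0 : ℂ) (half_pos one_pos)] with u hu
  rw [mem_closedBall_zero_iff] at hu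
  have hlt : ‖u‖ < 1 := by linarith
  have hterm : ∀ k, ‖c k * u ^ k‖ ≤ ‖u‖ ^ k := fun k => by
    rw [norm_mul, norm_pow]
    exact mul_le_of_le_one_left (by positivity) (hc k)
  have hsum : Summable fun k => c k * u ^ k :=
    .of_norm_bounded (summable_geometric_of_lt_one (norm_nonneg u) hlt) hterm
  rw [← hsum.sum_add_tsum_nat_add n, add_sub_cancel_left, norm_pow]
  refine (tsum_of_norm_bounded
    ((hasSum_geometric_of_lt_one (norm_nonneg u) hlt).mul_left (‖u‖ ^ n)) fun k =>
      (hterm (k + n)).trans_eq (by ring)).trans ?_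
  rw [mul_comm]
  gcongr
  exact inv_le_of_inv_le₀ (by norm_num) (by linarith)

/-- The local factor as a function of `u = p ^ (-s)`. -/
noncomputable def localFactor (ε : ℕ → ℂ) (z w u : ℂ) : ℂ :=
  (1 - u) ^ z * (1 - u ^ 2) ^ w * ∑' k : ℕ, ε k * u ^ k

theorem continuousOn_localFactor {ε : ℕ → ℂ} (hε : ∀ k, ‖ε k‖ ≤ 1) (z w : ℂ) {r : ℝ}
    (hr : r < 1) : ContinuousOn (localFactor ε z w) (Metric.closedBall 0 r) := by
  have hslit : ∀ v : ℂ, ‖v‖ < 1 → 1 - v ∈ Complex.slitPlane := fun v hv => by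
    simpa [sub_eq_add_neg] using
      Complex.mem_slitPlane_of_norm_lt_one (z := -v) (by simpa using hv)
  have hlt : ∀ u ∈ Metric.closedBall (0 : ℂ) r, ‖u‖ < 1 := fun u hu =>
    (mem_closedBall_zero_iff.1 hu).trans_lt hr
  refine (ContinuousOn.mul ?_ ?_).mul (continuousOn_tsum_mul_pow hε hr)
  · exact ContinuousOn.cpow_const (by fun_prop) fun u hu => hslit u (hlt u hu)
  · refine ContinuousOn.cpow_const (by fun_prop) fun u hu => hslit _ ?_
    rw [norm_pow]
    exact pow_lt_one₀ (norm_nonneg u) (hlt u hu) two_ne_zero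

theorem localFactor_sub_one_isBigO {ε : ℕ → ℂ} (hε0 : ε 0 = 1) (hε : ∀ k, ‖ε k‖ ≤ 1) :
    (fun u => localFactor ε (ε 1) (ε 2 - ε 1 * (ε 1 + 1) / 2) u - 1)
      =O[𝓝 0] fun u : ℂ => u ^ 3 := by
  set z := ε 1 with hz
  set w := ε 2 - z * (z + 1) / 2 with hw
  have hA := one_sub_cpow_isBigO z
  have hB := one_sub_sq_cpow_isBigO w
  have hG := tsum_mul_pow_sub_sum_isBigO hε 3
  have bdd : ∀ {f : ℂ → ℂ}, ContinuousAt f 0 → f =O[𝓝 0] fun _ => (1 : ℂ) :=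
    fun hf => hf.tendsto.isBigO_one ℂ
  have hGc : ContinuousAt (fun u : ℂ => ∑' k, ε k * u ^ k) 0 :=
    (continuousOn_tsum_mul_pow hε one_half_lt_one).continuousAt
      (Metric.closedBall_mem_nhds _ (by norm_num))
  have hBc : ContinuousAt (fun u : ℂ => (1 - u ^ 2) ^ w) 0 :=
    ContinuousAt.cpow (by fun_prop) continuousAt_const (by simp)
  have h₁ := hA.mul (bdd (hBc.mul hGc))
  have h₂ := hB.mul (bdd ((by fun_prop : ContinuousAt
    (fun u : ℂ => 1 - z * u + z * (z - 1) / 2 * u ^ 2) 0).mul hGc))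
  have h₃ := hG.mul (bdd (by fun_prop : ContinuousAt
    (fun u : ℂ => (1 - z * u + z * (z - 1) / 2 * u ^ 2) * (1 - w * u ^ 2)) 0))
  have h₄ := (isBigO_refl (fun u : ℂ => u ^ 3) (𝓝 0)).mul (bdd (by fun_prop : ContinuousAt
    (fun u : ℂ => (z * (z - 1) / 2 - ε 2) * z + (z * (z - 1) / 2 * ε 2 - w ^ 2) * u
      - w * z * (z * (z - 1) / 2 - ε 2) * u ^ 2 - w * (z * (z - 1) / 2) * ε 2 * u ^ 3) 0))
  simp only [mul_one, Pi.mul_apply] at h₁ h₂ h₃ h₄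
  refine (((h₁.add h₂).add h₃).add h₄).congr_left fun u => ?_
  simp only [localFactor, Finset.sum_range_succ, Finset.sum_range_zero, hε0, ← hz]
  generalize (∑' k, ε k * u ^ k) = G
  generalize (1 - u) ^ z = A
  generalize (1 - u ^ 2) ^ w = B
  rw [hw]
  ring

/-- For fixed `σ₁ > 1/3` there is `C > 0` (depending only on `σ₁` and
the sequence `ε`) such that `‖G_p(s) − 1‖ ≤ C p^{−3σ₁}` for every prime `p` and every
`s` with `Re s ≥ σ₁`. -/
theorem fakeMu_local_factor_bound
    (ε : ℕ → ℂ) (hε0 : ε 0 = 1)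
    (hε : ∀ k, 1 ≤ k → ‖ε k‖ = 1 ∨ ε k = 0)
    (z w : ℂ) (hz : z = ε 1) (hw : w = ε 2 - ε 1 * (ε 1 + 1) / 2)
    (σ₁ : ℝ) (hσ₁ : 1 / 3 < σ₁) :
    ∃ C : ℝ, 0 < C ∧ ∀ p : ℕ, p.Prime → ∀ s : ℂ, σ₁ ≤ s.re →
      ‖(1 - (p : ℂ) ^ (-s)) ^ z * (1 - (p : ℂ) ^ (-(2 * s))) ^ w *
          (∑' k : ℕ, ε k * ((p : ℂ) ^ (-s)) ^ k) - 1‖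
        ≤ C * (p : ℝ) ^ (-(3 * σ₁)) := by
  subst hz hw
  have hbound : ∀ k, ‖ε k‖ ≤ 1 := fun k => by
    rcases k.eq_zero_or_pos with rfl | hk
    · simp [hε0]
    · rcases hε k hk with h | h <;> simp [h]
  have hr : (2 : ℝ) ^ (-σ₁) < 1 := Real.rpow_lt_one_of_one_lt_of_neg one_lt_two (by linarith)
  obtain ⟨C, hC, h⟩ := exists_norm_le_mul_pow_of_isBigO
    ((continuousOn_localFactor hbound _ _ hr).sub continuousOn_const)
    (localFactor_sub_one_isBigO hε0 hbound)
  refine ⟨C, hC, fun p hp s hs => ?_⟩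
  have hu : ‖(p : ℂ) ^ (-s)‖ ≤ (p : ℝ) ^ (-σ₁) := by
    rw [Complex.norm_natCast_cpow_of_pos hp.pos]
    exact Real.rpow_le_rpow_of_exponent_le (mod_cast hp.one_le) (by simpa using hs)
  have hp2 : (p : ℝ) ^ (-σ₁) ≤ 2 ^ (-σ₁) :=
    Real.rpow_le_rpow_of_nonpos two_pos (mod_cast hp.two_le) (by linarith)
  have hsq : (p : ℂ) ^ (-(2 * s)) = ((p : ℂ) ^ (-s)) ^ 2 := by
    rw [← Complex.cpow_nat_mul]
    congr 1
    push_cast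
    ring
  rw [hsq]
  refine (h _ (hu.trans hp2)).trans ?_
  gcongr
  calc ‖(p : ℂ) ^ (-s)‖ ^ 3 ≤ ((p : ℝ) ^ (-σ₁)) ^ 3 := by gcongr
    _ = (p : ℝ) ^ (-(3 * σ₁)) := by
      rw [← Real.rpow_mul_natCast (Nat.cast_nonneg p)]
      congr 1
      push_cast
      ring
end

section
/- Let m ≥ 1 be an integer and ξ := e^{2πi/m}. For every s with Re s > 1, each Dirichlet series F_{ξ^j}(s) := ∑_{n≥1} ξ^{j·Ω(n)} n^{−s} (0 ≤ j ≤ m−1) converges absolutely, and ∏_{j=0}^{m−1} F_{ξ^j}(s) = ζ(ms), where ζ is the Riemann zeta function. -/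
/-- The completely multiplicative function `n ↦ η ^ Ω(n) * n ^ (-s)`, vanishing at `0`. -/
noncomputable def cardFactorsTwist (η : ℂ) {s : ℂ} (hs : s ≠ 0) : ℕ →*₀ ℂ where
  toFun n := η ^ ArithmeticFunction.cardFactors n * (n : ℂ) ^ (-s)
  map_zero' := by simp [hs]
  map_one' := by simp
  map_mul' a b := by
    rcases eq_or_ne a 0 with rfl | ha
    · simp [hs]
    rcases eq_or_ne b 0 with rfl | hb
    · simp [hs]
    rw [ArithmeticFunction.cardFactors_mul ha hb, pow_add, Nat.cast_mul,
      Complex.natCast_mul_natCast_cpow]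
    ring

theorem summable_norm_cardFactorsTwist {η s : ℂ} (hη : ‖η‖ = 1) (hs : 1 < s.re) :
    Summable fun n : ℕ ↦ ‖η ^ ArithmeticFunction.cardFactors n * (n : ℂ) ^ (-s)‖ := by
  simpa [riemannZetaSummandHom, hη] using summable_riemannZetaSummand hs

theorem hasProd_cardFactorsTwist {η s : ℂ} (hη : ‖η‖ = 1) (hs : 1 < s.re) :
    HasProd (fun p : Nat.Primes ↦ (1 - η * (p : ℂ) ^ (-s))⁻¹)
      (∑' n : ℕ, η ^ ArithmeticFunction.cardFactors n * (n : ℂ) ^ (-s)) := by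
  have hs0 : s ≠ 0 := by
    rintro rfl
    norm_num at hs
  refine (EulerProduct.eulerProduct_completely_multiplicative_hasProd
    (f := cardFactorsTwist η hs0) (summable_norm_cardFactorsTwist hη hs)).congr_fun ?_
  intro p
  simp [cardFactorsTwist, ArithmeticFunction.cardFactors_apply_prime p.prop]

theorem IsPrimitiveRoot.prod_one_sub_pow_mul {R : Type*} [CommRing R] [IsDomain R] {ζ : R}
    {n : ℕ} (hζ : IsPrimitiveRoot ζ n) (hn : 0 < n) (x : R) :
    ∏ j ∈ Finset.range n, (1 - ζ ^ j * x) = 1 - x ^ n := by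
  simpa [Polynomial.eval_prod] using
    (congrArg (Polynomial.eval 1) (X_pow_sub_C_eq_prod hζ hn (a := x ^ n) rfl)).symm

/-- For `m ≥ 1`, `ξ = e^{2πi/m}` and `Re s > 1`, each Dirichlet series
`F_{ξ^j}(s) = ∑ ξ^{jΩ(n)} n^{−s}` converges absolutely and
`∏_{j=0}^{m−1} F_{ξ^j}(s) = ζ(ms)`. -/
theorem generalized_liouville_cyclotomic
    (m : ℕ) (hm : 1 ≤ m) (ξ : ℂ)
    (hξ : ξ = Complex.exp (2 * (Real.pi : ℂ) * Complex.I / (m : ℂ)))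
    (s : ℂ) (hs : 1 < s.re) :
    (∀ j < m, Summable (fun n : ℕ =>
      ‖(ξ ^ j) ^ (ArithmeticFunction.cardFactors n) * (n : ℂ) ^ (-s)‖)) ∧
    ∏ j ∈ Finset.range m,
        ∑' n : ℕ, (ξ ^ j) ^ (ArithmeticFunction.cardFactors n) * (n : ℂ) ^ (-s)
      = riemannZeta ((m : ℂ) * s) := by
  have hprim : IsPrimitiveRoot ξ m := hξ ▸ Complex.isPrimitiveRoot_exp m (by omega)
  have hnorm (j : ℕ) : ‖ξ ^ j‖ = 1 := by
    rw [norm_pow, hprim.norm'_eq_one (by omega), one_pow]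
  refine ⟨fun j _ ↦ summable_norm_cardFactorsTwist (hnorm j) hs, ?_⟩
  have hms : 1 < ((m : ℂ) * s).re := by
    have h1 : (1 : ℝ) ≤ m := by exact_mod_cast hm
    simp only [Complex.mul_re, Complex.natCast_re, Complex.natCast_im, zero_mul, sub_zero]
    nlinarith
  refine (hasProd_prod fun j _ ↦ hasProd_cardFactorsTwist (hnorm j) hs).unique ?_
  convert riemannZeta_eulerProduct_hasProd hms using 2 with p
  rw [Finset.prod_inv_distrib, hprim.prod_one_sub_pow_mul (by omega), ← Complex.cpow_nat_mul,
    mul_neg]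
end

section
/- Assume −1 < Re z < 1 and Re w < 1, and fix a ∈ (1/3, 1/2). For 0 < u < 1/2 − a one has ζ(1/2−u) < 0 and ζ(1−2u) < 0; define J_{1/2}(u) := (−ζ(1/2−u))^z · (2u·(−ζ(1−2u)))^w · (1−2u)^{−1} · G_𝔣(1/2−u) · Γ(1/2−u) (powers of positive reals via the real logarithm), and for x > 3 define Δ_{1/2}(x) := (sin(π(z+w))/π) · 2^{1−w} · x^{1/2} · ∫_0^{1/2−a} e^{−u·log x} u^{−w} J_{1/2}(u) du. Then the integral converges absolutely for every x > 3, and as x → ∞, Δ_{1/2}(x) · x^{−1/2} · (log x)^{1−w} → (sin(π(z+w))/π) · 2^{1−w} · Γ(1−w) · (−ζ(1/2))^z · G_𝔣(1/2) · √π, where (log x)^{1−w} := e^{(1−w) log log x}. -/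
open MeasureTheory Filter Topology Asymptotics Set

theorem isBigO_mul_sub_mul {α : Type*} {l : Filter α} {A B P Q h : α → ℂ}
    (hA : (fun x => A x - P x) =O[l] h) (hB : (fun x => B x - Q x) =O[l] h)
    (hP : P =O[l] fun _ => (1 : ℂ)) (hQ : Q =O[l] fun _ => (1 : ℂ))
    (hh : h =O[l] fun _ => (1 : ℂ)) :
    (fun x => A x * B x - P x * Q x) =O[l] h := by
  have hB1 : B =O[l] fun _ => (1 : ℂ) := by simpa using (hB.trans hh).add hQ
  have h1 := hA.mul hB1
  have h2 := hP.mul hB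
  simp only [mul_one, one_mul] at h1 h2
  exact (h1.add h2).congr_left fun x => by ring

theorem isBigO_one_add_cpow_sub_quadratic (a : ℂ) :
    (fun x : ℂ => (1 + x) ^ a - (1 + a * x + a * (a - 1) / 2 * x ^ 2))
      =O[𝓝 0] fun x => x ^ 3 := by
  have h := (Complex.one_add_cpow_hasFPowerSeriesAt_zero (a := a)).isBigO_sub_partialSum_pow 3
  simp_rw [← norm_pow] at h
  rw [isBigO_norm_right] at h
  refine h.congr_left fun x => ?_
  have h2 : Ring.choose a 2 = a * (a - 1) / 2 := by
    rw [Ring.choose_eq_smul]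
    simp [descPochhammer_succ_right, Polynomial.smeval_mul, Polynomial.smeval_sub,
      Nat.factorial]
    ring
  simp [FormalMultilinearSeries.partialSum, Finset.sum_range_succ, binomialSeries, h2]
  ring

theorem isBigO_tsum_sub_quadratic {ε : ℕ → ℂ} (hε : ∀ k, ‖ε k‖ ≤ 1) :
    (fun q : ℂ => (∑' k : ℕ, ε k * q ^ k) - (ε 0 + ε 1 * q + ε 2 * q ^ 2))
      =O[𝓝 0] fun q => q ^ 3 := by
  refine IsBigO.of_bound 2 ?_
  filter_upwards [Metric.ball_mem_nhds (0 : ℂ) (show (0 : ℝ) < 1 / 2 by norm_num)] with q hq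
  have hq' : ‖q‖ < 1 / 2 := by simpa using hq
  have hgeo : Summable fun k : ℕ => ‖q‖ ^ k :=
    summable_geometric_of_lt_one (norm_nonneg _) (by linarith)
  have hb : ∀ k, ‖ε k * q ^ k‖ ≤ ‖q‖ ^ k := fun k => by
    rw [norm_mul, norm_pow]
    exact mul_le_of_le_one_left (by positivity) (hε k)
  have hs : Summable fun k : ℕ => ε k * q ^ k := Summable.of_norm_bounded hgeo hb
  rw [← hs.sum_add_tsum_nat_add 3]
  have h3 : HasSum (fun k : ℕ => ‖q‖ ^ (k + 3)) ((1 - ‖q‖)⁻¹ * ‖q‖ ^ 3) := by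
    simpa [pow_add] using
      (hasSum_geometric_of_lt_one (norm_nonneg q) (by linarith)).mul_right (‖q‖ ^ 3)
  have h4 := tsum_of_norm_bounded h3 fun k => hb (k + 3)
  have h5 : (1 - ‖q‖)⁻¹ ≤ 2 := by
    rw [inv_le_comm₀ (by linarith) (by norm_num)]; linarith
  simp only [Finset.sum_range_succ, Finset.sum_range_zero, zero_add, pow_zero, mul_one, pow_one,
    add_sub_cancel_left]
  refine h4.trans ?_
  rw [norm_pow]
  gcongr

theorem isBigO_localFactor_sub_one {ε : ℕ → ℂ} (hε0 : ε 0 = 1) (hε : ∀ k, ‖ε k‖ ≤ 1) {w : ℂ}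
    (hw : w = ε 2 - ε 1 * (ε 1 + 1) / 2) :
    (fun q : ℂ => (1 - q) ^ ε 1 * (1 - q ^ 2) ^ w * (∑' k : ℕ, ε k * q ^ k) - 1)
      =O[𝓝 0] fun q => q ^ 3 := by
  have bdd : ∀ f : ℂ → ℂ, Continuous f → f =O[𝓝 0] fun _ => (1 : ℂ) := fun f hf =>
    hf.continuousAt.isBigO_one ℂ
  have hA : (fun q : ℂ => (1 - q) ^ ε 1 - (1 - ε 1 * q + ε 1 * (ε 1 - 1) / 2 * q ^ 2))
      =O[𝓝 0] fun q => q ^ 3 := by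
    have h := (isBigO_one_add_cpow_sub_quadratic (ε 1)).comp_tendsto
      (show Tendsto (fun q : ℂ => -q) (𝓝 0) (𝓝 0) by
        simpa using (continuous_neg (G := ℂ)).tendsto 0)
    refine (h.congr_left fun q => ?_).trans (IsBigO.of_bound 1 (by simp))
    simp only [Function.comp]
    ring_nf
  have hB : (fun q : ℂ => (1 - q ^ 2) ^ w - (1 - w * q ^ 2)) =O[𝓝 0] fun q => q ^ 3 := by
    have h := (isBigO_one_add_cpow_sub_quadratic w).comp_tendsto
      (show Tendsto (fun q : ℂ => -q ^ 2) (𝓝 0) (𝓝 0) by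
        simpa using (show Continuous fun q : ℂ => -q ^ 2 by fun_prop).tendsto 0)
    have h1 := (bdd (fun q => -q ^ 3) (by fun_prop)).mul
      (isBigO_refl (fun q : ℂ => q ^ 3) (𝓝 0))
    have h2 := (bdd (fun q => w * (w - 1) / 2 * q) (by fun_prop)).mul
      (isBigO_refl (fun q : ℂ => q ^ 3) (𝓝 0))
    simp only [one_mul] at h1 h2
    have h3 := h.trans (h1.congr_left (f₂ := (fun x => x ^ 3) ∘ fun q : ℂ => -q ^ 2)
      fun q => by simp only [Function.comp]; ring)
    refine (h3.add h2).congr_left fun q => ?_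
    simp only [Function.comp]
    ring_nf
  have hh := bdd (fun q => q ^ 3) (by fun_prop)
  have hABC := isBigO_mul_sub_mul
    (isBigO_mul_sub_mul hA hB (bdd _ (by fun_prop)) (bdd _ (by fun_prop)) hh)
    (isBigO_tsum_sub_quadratic hε) (bdd _ (by fun_prop)) (bdd _ (by fun_prop)) hh
  have hrest : (fun q : ℂ => (1 - ε 1 * q + ε 1 * (ε 1 - 1) / 2 * q ^ 2) * (1 - w * q ^ 2) *
      (ε 0 + ε 1 * q + ε 2 * q ^ 2) - 1) =O[𝓝 0] fun q => q ^ 3 := by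
    have := (bdd (fun q : ℂ => ε 1 * (ε 1 - 1) / 2 * (ε 1 + ε 2 * q) - ε 1 * ε 2
      - w * ((-ε 1 * (1 + ε 1 * q + ε 2 * q ^ 2) + ε 1 * (ε 1 - 1) / 2 * q *
        (1 + ε 1 * q + ε 2 * q ^ 2)) + (ε 1 + ε 2 * q))) (by fun_prop)).mul
        (isBigO_refl (fun q : ℂ => q ^ 3) (𝓝 0))
    simp only [one_mul] at this
    refine this.congr_left fun q => ?_
    rw [hε0, hw]
    ring
  exact (hABC.add hrest).congr_left fun q => by ring

theorem continuousOn_eulerProduct {ε : ℕ → ℂ} (hε0 : ε 0 = 1) (hε : ∀ k, ‖ε k‖ ≤ 1) {w : ℂ}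
    (hw : w = ε 2 - ε 1 * (ε 1 + 1) / 2) {a b : ℝ} (ha : 1 / 3 < a) :
    ContinuousOn (fun σ : ℝ => ∏' p : Nat.Primes,
      (1 - ((p : ℕ) : ℂ) ^ (-(σ : ℂ))) ^ ε 1 * (1 - ((p : ℕ) : ℂ) ^ (-(2 * (σ : ℂ)))) ^ w *
        (∑' k : ℕ, ε k * (((p : ℕ) : ℂ) ^ (-(σ : ℂ))) ^ k)) (Icc a b) := by
  have hp0 : ∀ p : Nat.Primes, ((p : ℕ) : ℂ) ≠ 0 := fun p => by exact_mod_cast p.2.ne_zero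
  have hp1 : ∀ p : Nat.Primes, (1 : ℝ) < ((p : ℕ) : ℝ) := fun p => by exact_mod_cast p.2.one_lt
  have hnorm : ∀ (p : Nat.Primes) (σ : ℝ), ‖((p : ℕ) : ℂ) ^ (-(σ : ℂ))‖ = ((p : ℕ) : ℝ) ^ (-σ) :=
    fun p σ => by
      rw [Complex.norm_natCast_cpow_of_pos p.2.pos]; simp
  have hnorm_le : ∀ (p : Nat.Primes) (σ : ℝ), a ≤ σ →
      ‖((p : ℕ) : ℂ) ^ (-(σ : ℂ))‖ ≤ ((p : ℕ) : ℝ) ^ (-a) := fun p σ h => by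
    rw [hnorm]
    exact Real.rpow_le_rpow_of_exponent_le (hp1 p).le (by linarith)
  have hlt : ∀ p : Nat.Primes, ((p : ℕ) : ℝ) ^ (-a) < 1 := fun p =>
    Real.rpow_lt_one_of_one_lt_of_neg (hp1 p) (by linarith)
  have hcpow : ∀ p : Nat.Primes, Continuous fun σ : ℝ => ((p : ℕ) : ℂ) ^ (-(σ : ℂ)) := fun p =>
    Continuous.const_cpow (by fun_prop) (Or.inl (hp0 p))
  have hsq : ∀ (p : Nat.Primes) (σ : ℝ),
      ((p : ℕ) : ℂ) ^ (-(2 * (σ : ℂ))) = (((p : ℕ) : ℂ) ^ (-(σ : ℂ))) ^ 2 := fun p σ => by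
    rw [← Complex.cpow_nat_mul]; congr 1; push_cast; ring
  have hslit : ∀ q : ℂ, ‖q‖ < 1 → 1 - q ∈ Complex.slitPlane := fun q hq => by
    simpa [sub_eq_add_neg] using Complex.mem_slitPlane_of_norm_lt_one (z := -q) (by simpa using hq)
  set f : Nat.Primes → ℝ → ℂ := fun p σ =>
    (1 - ((p : ℕ) : ℂ) ^ (-(σ : ℂ))) ^ ε 1 * (1 - ((p : ℕ) : ℂ) ^ (-(2 * (σ : ℂ)))) ^ w *
        (∑' k : ℕ, ε k * (((p : ℕ) : ℂ) ^ (-(σ : ℂ))) ^ k) with hf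
  have hcont : ∀ p, ContinuousOn (f p) (Icc a b) := by
    intro p
    have hq : ∀ σ ∈ Icc a b, ‖((p : ℕ) : ℂ) ^ (-(σ : ℂ))‖ < 1 := fun σ hσ =>
      (hnorm_le p σ hσ.1).trans_lt (hlt p)
    refine ((ContinuousOn.cpow_const ?_ ?_).mul (ContinuousOn.cpow_const ?_ ?_)).mul ?_
    · exact (continuous_const.sub (hcpow p)).continuousOn
    · exact fun σ hσ => hslit _ (hq σ hσ)
    · simp_rw [hsq]
      exact (continuous_const.sub ((hcpow p).pow 2)).continuousOn
    · intro σ hσ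
      rw [hsq]
      refine hslit _ ?_
      rw [norm_pow]
      exact pow_lt_one₀ (norm_nonneg _) (hq σ hσ) two_ne_zero
    · refine continuousOn_tsum (u := fun k => (((p : ℕ) : ℝ) ^ (-a)) ^ k)
        (fun k => (continuous_const.mul ((hcpow p).pow k)).continuousOn)
        (summable_geometric_of_lt_one (by positivity) (hlt p)) ?_
      intro k σ hσ
      rw [norm_mul, norm_pow]
      refine (mul_le_of_le_one_left (by positivity) (hε k)).trans ?_
      gcongr
      exact hnorm_le p σ hσ.1
  obtain ⟨C, hC⟩ := (isBigO_localFactor_sub_one hε0 hε hw).bound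
  obtain ⟨δ, hδ, hball⟩ := Metric.eventually_nhds_iff.1 hC
  have htend : Tendsto (fun p : Nat.Primes => ((p : ℕ) : ℝ) ^ (-a)) cofinite (𝓝 0) := by
    have h1 : Tendsto (fun n : ℕ => (n : ℝ) ^ (-a)) cofinite (𝓝 0) := by
      rw [Nat.cofinite_eq_atTop]
      exact (tendsto_rpow_neg_atTop (by linarith)).comp tendsto_natCast_atTop_atTop
    exact h1.comp (Nat.Primes.coe_nat_injective.tendsto_cofinite)
  have hsum : Summable fun p : Nat.Primes => |C| * (((p : ℕ) : ℝ) ^ (-a)) ^ 3 := by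
    refine Summable.mul_left _ ?_
    have : Summable fun p : Nat.Primes => ((p : ℕ) : ℝ) ^ (-(3 * a)) :=
      Nat.Primes.summable_rpow.2 (by linarith)
    refine this.congr fun p => ?_
    rw [← Real.rpow_mul_natCast (by positivity)]
    congr 1; push_cast; ring
  have hprod := hsum.hasProdUniformlyOn_one_add (f := fun p σ => f p σ - 1)
    (K := Icc a b) isCompact_Icc ?_ (fun p => (hcont p).sub continuousOn_const)
  · rw [hasProdUniformlyOn_iff_tendstoUniformlyOn] at hprod
    simp only [add_sub_cancel] at hprod
    exact hprod.continuousOn (Frequently.of_forall fun s => continuousOn_finsetProd s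
      fun p _ => hcont p)
  · filter_upwards [htend.eventually (gt_mem_nhds hδ)] with p hp σ hσ
    have hle := hnorm_le p σ hσ.1
    have := hball (y := ((p : ℕ) : ℂ) ^ (-(σ : ℂ))) (by simpa using hle.trans_lt hp)
    simp only [hf, hsq]
    refine this.trans ?_
    rw [norm_pow]
    gcongr
    exact le_abs_self C

theorem differentiableAt_mellin_fract {s : ℂ} (hs : s.re < 0) :
    DifferentiableAt ℂ (mellin ((Ioi (1 : ℝ)).indicator fun t => ((Int.fract t : ℝ) : ℂ))) s := by
  have hmeas : Measurable ((Ioi (1 : ℝ)).indicator fun t => ((Int.fract t : ℝ) : ℂ)) :=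
    (Complex.measurable_ofReal.comp measurable_fract).indicator measurableSet_Ioi
  have hb : ∀ t, ‖(Ioi (1 : ℝ)).indicator (fun t => ((Int.fract t : ℝ) : ℂ)) t‖ ≤ 1 := by
    intro t
    refine (norm_indicator_le_norm_self _ _).trans ?_
    simpa [abs_of_nonneg (Int.fract_nonneg t)] using (Int.fract_lt_one t).le
  refine mellin_differentiableAt_of_isBigO_rpow (a := 0) (b := s.re - 1) ?_ ?_ hs ?_ (by linarith)
  · refine LocallyIntegrable.locallyIntegrableOn ?_ _
    exact (locallyIntegrable_const (1 : ℝ)).mono hmeas.aestronglyMeasurable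
      (Eventually.of_forall fun t => by simpa using hb t)
  · exact IsBigO.of_bound 1 (Eventually.of_forall fun t => by simpa using hb t)
  · refine IsBigO.of_bound 1 ?_
    filter_upwards [Ioo_mem_nhdsGT (zero_lt_one (α := ℝ))] with t ht
    rw [indicator_of_notMem (by simpa using ht.2.le)]
    simp

theorem riemannZeta₁_eq_mellin_of_one_lt {s : ℂ} (hs : 1 < s.re) :
    riemannZeta₁ s = s - s * (s - 1) *
      mellin ((Ioi (1 : ℝ)).indicator fun t => ((Int.fract t : ℝ) : ℂ)) (-s) := by
  have hs1 : s ≠ 1 := fun h => by simp [h] at hs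
  have hs1' : s - 1 ≠ 0 := sub_ne_zero.2 hs1
  have hs0 : 0 < s.re := by linarith
  have h1 : (s - 1) * riemannZeta s = riemannZeta₁ s := by
    rw [riemannZeta_eq_inv_sub_mul hs1, mul_inv_cancel_left₀ hs1']
  have hL := LSeries_eq_mul_integral_of_nonneg (fun _ => 1) zero_le_one hs
    (by simpa using isBigO_refl (fun n : ℕ => (n : ℝ)) atTop) (fun _ => zero_le_one)
  have hz : LSeries (fun _ => ((1 : ℝ) : ℂ)) s = riemannZeta s := by
    rw [← LSeries_one_eq_riemannZeta hs]; simp [Pi.one_def]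
  rw [hz] at hL
  have hmel : mellin ((Ioi (1 : ℝ)).indicator fun t => ((Int.fract t : ℝ) : ℂ)) (-s)
      = ∫ t in Ioi (1 : ℝ), (t : ℂ) ^ (-s - 1) * ((Int.fract t : ℝ) : ℂ) := by
    rw [mellin]
    have : ∀ t : ℝ, (t : ℂ) ^ (-s - 1) •
        (Ioi (1 : ℝ)).indicator (fun t => ((Int.fract t : ℝ) : ℂ)) t =
        (Ioi (1 : ℝ)).indicator (fun t => (t : ℂ) ^ (-s - 1) * ((Int.fract t : ℝ) : ℂ)) t := by
      intro t
      by_cases ht : t ∈ Ioi (1 : ℝ) <;> simp [ht]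
    simp_rw [this]
    rw [setIntegral_indicator measurableSet_Ioi]
    congr 2
    ext t
    simp only [mem_inter_iff, mem_Ioi]
    constructor
    · exact fun h => h.2
    · exact fun h => ⟨by linarith, h⟩
  have hint1 : IntegrableOn (fun t : ℝ => (t : ℂ) ^ (-s)) (Ioi 1) :=
    integrableOn_Ioi_cpow_of_lt (by simpa using hs) one_pos
  have hint2 : IntegrableOn (fun t : ℝ => (t : ℂ) ^ (-s - 1) * ((Int.fract t : ℝ) : ℂ))
      (Ioi 1) := by
    have h0 : IntegrableOn (fun t : ℝ => (t : ℂ) ^ (-s - 1)) (Ioi 1) :=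
      integrableOn_Ioi_cpow_of_lt (by simp; linarith) one_pos
    refine h0.mul_bdd (c := 1)
      (Complex.measurable_ofReal.comp measurable_fract).aestronglyMeasurable
      (Eventually.of_forall fun t => ?_)
    simpa [abs_of_nonneg (Int.fract_nonneg t)] using (Int.fract_lt_one t).le
  have hfloor : ∫ t in Ioi (1 : ℝ), (∑ k ∈ Finset.Icc 1 ⌊t⌋₊, ((1 : ℝ) : ℂ)) * t ^ (-(s + 1))
      = ∫ t in Ioi (1 : ℝ), ((t : ℂ) ^ (-s) - (t : ℂ) ^ (-s - 1) * ((Int.fract t : ℝ) : ℂ)) := by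
    refine setIntegral_congr_fun measurableSet_Ioi fun t ht => ?_
    have ht0 : (0 : ℝ) < t := lt_trans one_pos ht
    have htc : (t : ℂ) ≠ 0 := by exact_mod_cast ht0.ne'
    have e1 : (t : ℂ) ^ (-s) = t * (t : ℂ) ^ (-s - 1) := by
      rw [Complex.cpow_sub _ _ htc, Complex.cpow_one, mul_div_cancel₀ _ htc]
    have e2 : ((⌊t⌋₊ : ℝ)) = t - Int.fract t := by
      rw [natCast_floor_eq_intCast_floor ht0.le, Int.self_sub_fract]
    have e3 : ((⌊t⌋₊ : ℂ)) = t - ((Int.fract t : ℝ) : ℂ) := by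
      have := congrArg (fun x : ℝ => (x : ℂ)) e2
      push_cast at this
      exact_mod_cast this
    simp only [e1, Finset.sum_const, Nat.card_Icc, add_tsub_cancel_right, nsmul_eq_mul,
      Complex.ofReal_one, mul_one, e3, show -(s + 1) = -s - 1 by ring]
    ring
  rw [hfloor, integral_sub hint1 hint2, ← hmel,
    integral_Ioi_cpow_of_lt (by simpa using hs) one_pos] at hL
  rw [← h1, hL]
  have : -s + 1 ≠ 0 := fun h => hs1' (by linear_combination -h)
  simp only [Complex.ofReal_one, Complex.one_cpow]
  field_simp
  ring

theorem riemannZeta₁_eq_mellin {s : ℂ} (hs : 0 < s.re) :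
    riemannZeta₁ s = s - s * (s - 1) *
      mellin ((Ioi (1 : ℝ)).indicator fun t => ((Int.fract t : ℝ) : ℂ)) (-s) := by
  have hopen : IsOpen {s : ℂ | 0 < s.re} := isOpen_lt continuous_const Complex.continuous_re
  have hd : DifferentiableOn ℂ (fun s : ℂ => s - s * (s - 1) *
      mellin ((Ioi (1 : ℝ)).indicator fun t => ((Int.fract t : ℝ) : ℂ)) (-s))
      {s : ℂ | 0 < s.re} := by
    intro s hs
    have := (differentiableAt_mellin_fract (s := -s) (by simpa using hs)).fun_comp' s
      (differentiableAt_id.neg)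
    exact (differentiableAt_id.sub ((differentiableAt_id.mul
      (differentiableAt_id.sub_const 1)).mul this)).differentiableWithinAt
  refine AnalyticOnNhd.eqOn_of_preconnected_of_eventuallyEq (z₀ := 2)
    (differentiable_riemannZeta₁.differentiableOn.analyticOnNhd hopen) (hd.analyticOnNhd hopen)
    (convex_halfSpace_re_gt 0).isPreconnected (by simp) ?_ hs
  filter_upwards [(isOpen_lt continuous_const Complex.continuous_re).mem_nhds
    (show (2 : ℂ) ∈ {s : ℂ | 1 < s.re} by simp)] with s hs
  exact riemannZeta₁_eq_mellin_of_one_lt hs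

theorem exists_neg_riemannZeta_eq {σ : ℝ} (h0 : 0 < σ) (h1 : σ < 1) :
    ∃ y : ℝ, y < 0 ∧ riemannZeta (σ : ℂ) = (y : ℂ) := by
  set M : ℝ := ∫ t in Ioi (0 : ℝ),
    t ^ (-σ - 1) * (Ioi (1 : ℝ)).indicator (fun t => Int.fract t) t
  have hM : mellin ((Ioi (1 : ℝ)).indicator fun t => ((Int.fract t : ℝ) : ℂ)) (-(σ : ℂ))
      = (M : ℂ) := by
    rw [mellin, ← integral_complex_ofReal]
    refine setIntegral_congr_fun measurableSet_Ioi fun t ht => ?_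
    have : (t : ℂ) ^ (-(σ : ℂ) - 1) = ((t ^ (-σ - 1) : ℝ) : ℂ) := by
      rw [Complex.ofReal_cpow (le_of_lt ht)]; push_cast; rfl
    simp only [smul_eq_mul, this]
    by_cases h : t ∈ Ioi (1 : ℝ) <;> simp [h]
  have hM0 : 0 ≤ M := setIntegral_nonneg measurableSet_Ioi fun t ht =>
    mul_nonneg (Real.rpow_nonneg (le_of_lt ht) _)
      (indicator_nonneg (fun t _ => Int.fract_nonneg t) t)
  have hne : (σ : ℂ) ≠ 1 := by exact_mod_cast h1.ne
  refine ⟨σ / (σ - 1) - σ * M, ?_, ?_⟩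
  · have := div_neg_of_pos_of_neg h0 (sub_neg.2 h1)
    nlinarith [mul_nonneg h0.le hM0]
  · rw [riemannZeta_eq_inv_sub_mul hne, riemannZeta₁_eq_mellin (by simpa using h0), hM]
    have : (σ : ℂ) - 1 ≠ 0 := sub_ne_zero.2 hne
    push_cast
    field_simp

theorem integrableOn_exp_mul_cpow_mul {f : ℝ → ℂ} {c : ℝ} (hf : ContinuousOn f (Icc 0 c))
    {w : ℂ} (hw : w.re < 1) (L : ℝ) :
    IntegrableOn (fun u : ℝ => Complex.exp (-((u * L : ℝ) : ℂ)) * (u : ℂ) ^ (-w) * f u)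
      (Ioo 0 c) := by
  rcases le_or_gt c 0 with hc | hc
  · simp [Ioo_eq_empty (not_lt.2 hc)]
  have h1 : IntegrableOn (fun u : ℝ => (u : ℂ) ^ (-w)) (Icc 0 c) := by
    have := intervalIntegral.intervalIntegrable_cpow' (a := 0) (b := c) (r := -w)
      (by simp; linarith)
    rwa [intervalIntegrable_iff_integrableOn_Icc_of_le hc.le] at this
  have h2 : ContinuousOn (fun u : ℝ => Complex.exp (-((u * L : ℝ) : ℂ)) * f u) (Icc 0 c) :=
    (by fun_prop : Continuous fun u : ℝ => Complex.exp (-((u * L : ℝ) : ℂ))).continuousOn.mul hf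
  refine ((h1.continuousOn_mul h2 isCompact_Icc).mono_set Ioo_subset_Icc_self).congr_fun
    (fun u _ => ?_) measurableSet_Ioo
  simp only
  ring

theorem cpow_mul_laplace_eq (f : ℝ → ℂ) (c : ℝ) (w : ℂ) {L : ℝ} (hL : 0 < L) :
    (L : ℂ) ^ (1 - w) *
        ∫ u in Ioo 0 c, Complex.exp (-((u * L : ℝ) : ℂ)) * (u : ℂ) ^ (-w) * f u =
      ∫ t in Ioi (0 : ℝ), Complex.exp (-(t : ℂ)) * (t : ℂ) ^ (-w) *
        (Ioo 0 c).indicator f (L⁻¹ * t) := by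
  have hLc : (L : ℂ) ≠ 0 := by exact_mod_cast hL.ne'
  have hset : ∫ u in Ioo 0 c, Complex.exp (-((u * L : ℝ) : ℂ)) * (u : ℂ) ^ (-w) * f u =
      ∫ u in Ioi (0 : ℝ), Complex.exp (-((u * L : ℝ) : ℂ)) * (u : ℂ) ^ (-w) *
        (Ioo 0 c).indicator f u := by
    have : ∀ u : ℝ, Complex.exp (-((u * L : ℝ) : ℂ)) * (u : ℂ) ^ (-w) *
        (Ioo 0 c).indicator f u = (Ioo 0 c).indicator
          (fun u : ℝ => Complex.exp (-((u * L : ℝ) : ℂ)) * (u : ℂ) ^ (-w) * f u) u := by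
      intro u
      by_cases hu : u ∈ Ioo 0 c <;> simp [hu]
    simp_rw [this]
    rw [setIntegral_indicator measurableSet_Ioo, inter_eq_right.2 Ioo_subset_Ioi_self]
  have hsub := integral_comp_mul_left_Ioi (fun u : ℝ =>
    Complex.exp (-((u * L : ℝ) : ℂ)) * (u : ℂ) ^ (-w) * (Ioo 0 c).indicator f u) 0
      (inv_pos.2 hL)
  rw [mul_zero, inv_inv, Complex.real_smul] at hsub
  rw [hset, Complex.cpow_sub _ _ hLc, Complex.cpow_one, div_mul_eq_mul_div, ← hsub,
    div_eq_mul_inv, mul_comm, ← Complex.cpow_neg, ← integral_const_mul]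
  refine setIntegral_congr_fun measurableSet_Ioi fun t ht => ?_
  have hmul : (L : ℂ) ^ (-w) * ((L⁻¹ * t : ℝ) : ℂ) ^ (-w) = (t : ℂ) ^ (-w) := by
    rw [← Complex.mul_cpow_ofReal_nonneg hL.le (mul_nonneg (inv_pos.2 hL).le (le_of_lt ht)),
      ← Complex.ofReal_mul, mul_inv_cancel_left₀ hL.ne']
  have hexp : L⁻¹ * t * L = t := by field_simp
  simp only [hexp, ← hmul]
  ring

theorem tendsto_cpow_mul_laplace {f : ℝ → ℂ} {c : ℝ} (hc : 0 < c)
    (hf : ContinuousOn f (Icc 0 c)) {w : ℂ} (hw : w.re < 1) :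
    Tendsto (fun L : ℝ => (L : ℂ) ^ (1 - w) *
        ∫ u in Ioo 0 c, Complex.exp (-((u * L : ℝ) : ℂ)) * (u : ℂ) ^ (-w) * f u)
      atTop (𝓝 (Complex.Gamma (1 - w) * f 0)) := by
  obtain ⟨M, hM⟩ := isCompact_Icc.exists_bound_of_continuousOn hf
  have hM0 : 0 ≤ M := (norm_nonneg _).trans (hM 0 ⟨le_rfl, hc.le⟩)
  have hG : Complex.Gamma (1 - w) * f 0 =
      ∫ t in Ioi (0 : ℝ), Complex.exp (-(t : ℂ)) * (t : ℂ) ^ (-w) * f 0 := by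
    rw [Complex.Gamma_eq_integral (by simp; linarith), Complex.GammaIntegral, ← integral_mul_const]
    simp
  have hint : IntegrableOn (fun t : ℝ => Complex.exp (-(t : ℂ)) * (t : ℂ) ^ (-w)) (Ioi 0) := by
    have := Complex.GammaIntegral_convergent (s := 1 - w) (by simp; linarith)
    simpa using this
  have hind : AEStronglyMeasurable ((Ioo 0 c).indicator f) volume :=
    (aestronglyMeasurable_indicator_iff measurableSet_Ioo).2
      ((hf.mono Ioo_subset_Icc_self).aestronglyMeasurable measurableSet_Ioo)
  rw [hG]
  refine Tendsto.congr' (f₁ := fun L : ℝ => ∫ t in Ioi (0 : ℝ), Complex.exp (-(t : ℂ)) *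
    (t : ℂ) ^ (-w) * (Ioo 0 c).indicator f (L⁻¹ * t)) ?_ ?_
  · filter_upwards [eventually_gt_atTop 0] with L hL
    exact (cpow_mul_laplace_eq f c w hL).symm
  refine tendsto_integral_filter_of_dominated_convergence
    (fun t => ‖Complex.exp (-(t : ℂ)) * (t : ℂ) ^ (-w)‖ * M) ?_ ?_ (hint.norm.mul_const M) ?_
  · filter_upwards [eventually_gt_atTop 0] with L hL
    refine hint.aestronglyMeasurable.mul ?_
    exact (hind.comp_quasiMeasurePreserving
      (Measure.quasiMeasurePreserving_smul volume (inv_pos.2 hL).ne')).restrict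
  · refine Eventually.of_forall fun L => Eventually.of_forall fun t => ?_
    rw [norm_mul]
    gcongr
    by_cases h : L⁻¹ * t ∈ Ioo 0 c
    · rw [indicator_of_mem h]; exact hM _ (Ioo_subset_Icc_self h)
    · rw [indicator_of_notMem h]; simpa using hM0
  · refine (ae_restrict_iff' measurableSet_Ioi).2 (Eventually.of_forall fun t ht => ?_)
    refine Tendsto.const_mul _ ?_
    have h0 : Tendsto (fun L : ℝ => L⁻¹ * t) atTop (𝓝 0) := by
      simpa using tendsto_inv_atTop_zero.mul_const t
    have hmem : ∀ᶠ L : ℝ in atTop, L⁻¹ * t ∈ Ioo 0 c := by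
      filter_upwards [eventually_gt_atTop 0, h0.eventually (gt_mem_nhds hc)] with L hL hL'
      exact ⟨mul_pos (inv_pos.2 hL) ht, hL'⟩
    have hlim : Tendsto (fun L : ℝ => f (L⁻¹ * t)) atTop (𝓝 (f 0)) :=
      (hf 0 ⟨le_rfl, hc.le⟩).tendsto.comp (tendsto_nhdsWithin_iff.2
        ⟨h0, hmem.mono fun L h => Ioo_subset_Icc_self h⟩)
    refine hlim.congr' ?_
    filter_upwards [hmem] with L h
    rw [indicator_of_mem h]

/-- For `−1 < Re z < 1`, `Re w < 1`, `a ∈ (1/3,1/2)`: on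
`0 < u < 1/2 − a` one has `ζ(1/2−u) < 0` and `ζ(1−2u) < 0`; the Laplace integral
defining `Δ_{1/2}(x)` converges absolutely for `x > 3`; and
`Δ_{1/2}(x) x^{−1/2} (log x)^{1−w} → (sin(π(z+w))/π) 2^{1−w} Γ(1−w) (−ζ(1/2))^z G_𝔣(1/2) √π`
as `x → ∞`. -/
theorem delta_half_asymptotics
    (ε : ℕ → ℂ) (hε0 : ε 0 = 1)
    (hε : ∀ k, 1 ≤ k → ‖ε k‖ = 1 ∨ ε k = 0)
    (z w : ℂ) (hz : z = ε 1) (hw : w = ε 2 - ε 1 * (ε 1 + 1) / 2)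
    (hz1 : -1 < z.re) (hz2 : z.re < 1) (hw1 : w.re < 1)
    (a : ℝ) (ha1 : 1 / 3 < a) (ha2 : a < 1 / 2)
    (G : ℂ → ℂ)
    (hG : ∀ s : ℂ, G s = ∏' p : Nat.Primes,
      (1 - ((p : ℕ) : ℂ) ^ (-s)) ^ z * (1 - ((p : ℕ) : ℂ) ^ (-(2 * s))) ^ w *
        (∑' k : ℕ, ε k * (((p : ℕ) : ℂ) ^ (-s)) ^ k))
    (J : ℝ → ℂ)
    (hJ : ∀ u : ℝ, J u =
      (-(riemannZeta (1 / 2 - (u : ℂ)))) ^ z *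
        ((2 * (u : ℂ)) * (-(riemannZeta (1 - 2 * (u : ℂ))))) ^ w *
        (1 - 2 * (u : ℂ))⁻¹ * G (1 / 2 - (u : ℂ)) * Complex.Gamma (1 / 2 - (u : ℂ)))
    (Δ : ℝ → ℂ)
    (hΔ : ∀ x : ℝ, Δ x =
      (Complex.sin ((Real.pi : ℂ) * (z + w)) / (Real.pi : ℂ)) *
        (2 : ℂ) ^ ((1 : ℂ) - w) * ((Real.sqrt x : ℝ) : ℂ) *
        ∫ u in Set.Ioo (0 : ℝ) (1 / 2 - a),
          Complex.exp (-((u * Real.log x : ℝ) : ℂ)) * ((u : ℂ) ^ (-w)) * J u) :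
    (∀ u ∈ Set.Ioo (0 : ℝ) (1 / 2 - a),
      (∃ y : ℝ, y < 0 ∧ riemannZeta (1 / 2 - (u : ℂ)) = (y : ℂ)) ∧
      (∃ y : ℝ, y < 0 ∧ riemannZeta (1 - 2 * (u : ℂ)) = (y : ℂ))) ∧
    (∀ x : ℝ, 3 < x → IntegrableOn
      (fun u : ℝ => Complex.exp (-((u * Real.log x : ℝ) : ℂ)) * ((u : ℂ) ^ (-w)) * J u)
      (Set.Ioo (0 : ℝ) (1 / 2 - a))) ∧
    Filter.Tendsto
      (fun x : ℝ => Δ x / ((Real.sqrt x : ℝ) : ℂ) * ((Real.log x : ℂ)) ^ ((1 : ℂ) - w))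
      Filter.atTop
      (nhds ((Complex.sin ((Real.pi : ℂ) * (z + w)) / (Real.pi : ℂ)) *
        (2 : ℂ) ^ ((1 : ℂ) - w) * Complex.Gamma (1 - w) *
        (-(riemannZeta (1 / 2))) ^ z * G (1 / 2) *
        ((Real.sqrt Real.pi : ℝ) : ℂ))) := by
  have hc : 0 < 1 / 2 - a := by linarith
  have hε1 : ∀ k, ‖ε k‖ ≤ 1 := by
    intro k
    rcases Nat.eq_zero_or_pos k with rfl | hk
    · simp [hε0]
    · rcases hε k hk with h | h <;> simp [h]
  have hneg1 : ∀ u ∈ Icc (0 : ℝ) (1 / 2 - a),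
      ∃ y : ℝ, y < 0 ∧ riemannZeta (1 / 2 - (u : ℂ)) = (y : ℂ) := by
    intro u hu
    simpa using exists_neg_riemannZeta_eq (σ := 1 / 2 - u) (by linarith [hu.2])
      (by linarith [hu.1])
  have hneg2 : ∀ u ∈ Ioo (0 : ℝ) (1 / 2 - a),
      ∃ y : ℝ, y < 0 ∧ riemannZeta (1 - 2 * (u : ℂ)) = (y : ℂ) := by
    intro u hu
    simpa using exists_neg_riemannZeta_eq (σ := 1 - 2 * u) (by linarith [hu.2])
      (by linarith [hu.1])
  have hres : ∀ u : ℝ, u ≠ 0 → (2 * (u : ℂ)) * (-(riemannZeta (1 - 2 * (u : ℂ)))) =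
      riemannZeta₁ (1 - 2 * (u : ℂ)) := by
    intro u hu
    have huc : (u : ℂ) ≠ 0 := by exact_mod_cast hu
    rw [riemannZeta_eq_inv_sub_mul (s := 1 - 2 * (u : ℂ)) (by simpa using huc)]
    have : (1 - 2 * (u : ℂ) - 1) = -(2 * u) := by ring
    rw [this]
    field_simp
  set K : ℝ → ℂ := fun u => (-(riemannZeta (1 / 2 - (u : ℂ)))) ^ z *
    (riemannZeta₁ (1 - 2 * (u : ℂ))) ^ w * (1 - 2 * (u : ℂ))⁻¹ * G (1 / 2 - (u : ℂ)) *
      Complex.Gamma (1 / 2 - (u : ℂ)) with hK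
  have hJK : ∀ u ∈ Ioo (0 : ℝ) (1 / 2 - a), J u = K u := by
    intro u hu
    rw [hJ, hres u hu.1.ne']
  have hGcont : ContinuousOn (fun u : ℝ => G (1 / 2 - (u : ℂ))) (Icc 0 (1 / 2 - a)) := by
    have h := (continuousOn_eulerProduct hε0 hε1 hw (b := 1 / 2) ha1).comp
      (f := fun u : ℝ => 1 / 2 - u) (s := Icc 0 (1 / 2 - a))
      (by fun_prop) (fun u hu => ⟨by linarith [hu.2], by linarith [hu.1]⟩)
    refine h.congr fun u _ => ?_
    rw [hG, hz]
    simp [Function.comp]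
  have hKcont : ContinuousOn K (Icc 0 (1 / 2 - a)) := by
    refine (((ContinuousOn.mul ?_ ?_).mul ?_).mul hGcont).mul ?_
    · refine ContinuousOn.cpow_const (fun u hu => ?_) fun u hu => ?_
      · have hne : (1 / 2 - (u : ℂ)) ≠ 1 := fun h => by
          have := congrArg Complex.re h
          norm_num at this
          linarith [hu.1]
        have hcont : Continuous fun u : ℝ => (1 / 2 - (u : ℂ)) := by fun_prop
        exact ((differentiableAt_riemannZeta hne).continuousAt.comp
          (f := fun u : ℝ => (1 / 2 - (u : ℂ))) hcont.continuousAt).neg.continuousWithinAt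
      · obtain ⟨y, hy, h⟩ := hneg1 u hu
        rw [h]
        exact Or.inl (by simpa using hy)
    · refine ContinuousOn.cpow_const ?_ fun u hu => ?_
      · exact (differentiable_riemannZeta₁.continuous.comp
          (by fun_prop : Continuous fun u : ℝ => (1 - 2 * (u : ℂ)))).continuousOn
      · rcases hu.1.eq_or_lt with rfl | h0
        · simp
        · obtain ⟨y, hy, h⟩ : ∃ y : ℝ, y < 0 ∧ riemannZeta (1 - 2 * (u : ℂ)) = (y : ℂ) := by
            simpa using exists_neg_riemannZeta_eq (σ := 1 - 2 * u) (by linarith [hu.2])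
              (by linarith)
          rw [← hres u h0.ne', h]
          refine Or.inl ?_
          simp only [← Complex.ofReal_neg, ← Complex.ofReal_ofNat, ← Complex.ofReal_mul,
            Complex.ofReal_re]
          exact mul_pos (by linarith) (by linarith)
    · refine ContinuousOn.inv₀ (by fun_prop) fun u hu h => ?_
      have := congrArg Complex.re h
      norm_num at this
      linarith [hu.2]
    · intro u hu
      have hcont : Continuous fun u : ℝ => (1 / 2 - (u : ℂ)) := by fun_prop
      refine ((Complex.differentiableAt_Gamma _ fun m h => ?_).continuousAt.comp
          (f := fun u : ℝ => (1 / 2 - (u : ℂ))) hcont.continuousAt).continuousWithinAt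
      have := congrArg Complex.re h
      norm_num at this
      have hm : (0 : ℝ) ≤ m := m.cast_nonneg
      linarith [hu.2]
  refine ⟨fun u hu => ⟨hneg1 u (Ioo_subset_Icc_self hu), hneg2 u hu⟩, fun x _ => ?_, ?_⟩
  · refine (integrableOn_exp_mul_cpow_mul hKcont hw1 (Real.log x)).congr_fun (fun u hu => ?_)
      measurableSet_Ioo
    simp only [hJK u hu]
  have hlim := ((tendsto_cpow_mul_laplace hc hKcont hw1).comp Real.tendsto_log_atTop).const_mul
    (Complex.sin ((Real.pi : ℂ) * (z + w)) / (Real.pi : ℂ) * (2 : ℂ) ^ ((1 : ℂ) - w))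
  have hK0 : K 0 = (-(riemannZeta (1 / 2))) ^ z * G (1 / 2) * ((Real.sqrt Real.pi : ℝ) : ℂ) := by
    have hΓ : Complex.Gamma (1 / 2) = ((Real.sqrt Real.pi : ℝ) : ℂ) := by
      rw [← Real.Gamma_one_half_eq, ← Complex.Gamma_ofReal]
      simp
    simp only [hK, Complex.ofReal_zero, mul_zero, sub_zero, riemannZeta₁_one, Complex.one_cpow,
      inv_one, mul_one, hΓ]
  rw [hK0] at hlim
  refine (hlim.congr' ?_).trans_eq ?_
  · filter_upwards [eventually_gt_atTop 0] with x hx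
    have hsqrt : ((Real.sqrt x : ℝ) : ℂ) ≠ 0 := by exact_mod_cast (Real.sqrt_pos.2 hx).ne'
    have hint : ∫ u in Ioo (0 : ℝ) (1 / 2 - a),
          Complex.exp (-((u * Real.log x : ℝ) : ℂ)) * ((u : ℂ) ^ (-w)) * J u =
        ∫ u in Ioo (0 : ℝ) (1 / 2 - a),
          Complex.exp (-((u * Real.log x : ℝ) : ℂ)) * ((u : ℂ) ^ (-w)) * K u :=
      setIntegral_congr_fun measurableSet_Ioo fun u hu => by simp only [hJK u hu]
    rw [hΔ, hint]
    simp only [Function.comp]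
    rw [mul_right_comm _ ((Real.sqrt x : ℝ) : ℂ), mul_div_cancel_right₀ _ hsqrt]
    ring
  · congr 1
    ring
end

section
/- Assume the Riemann Hypothesis. Fix σ₀ ∈ (1/2, 1) and A > 0. Then for every ε > 0 there exists a constant C > 0 such that for all σ ≥ σ₀, all real t with |t| ≥ 3, and every real number a with |a| ≤ A, one has |ζ(σ+it)|^a ≤ C (1+|t|)^ε (real powers of the positive number |ζ(σ+it)|). In particular, both |ζ(σ+it)| ≤ C(1+|t|)^ε and |ζ(σ+it)|^{−1} ≤ C(1+|t|)^ε hold uniformly in the region σ ≥ σ₀, |t| ≥ 3. -/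
open Complex Metric in
/-- A nonvanishing holomorphic function on a disc is a constant times an exponential. -/
theorem DifferentiableOn.exists_eq_mul_exp {f : ℂ → ℂ} {c : ℂ} {r : ℝ} (hr : 0 < r)
    (hf : DifferentiableOn ℂ f (ball c r)) (h0 : ∀ z ∈ ball c r, f z ≠ 0) :
    ∃ g : ℂ → ℂ, DifferentiableOn ℂ g (ball c r) ∧ g c = 0 ∧
      ∀ z ∈ ball c r, f z = f c * Complex.exp (g z) := by
  obtain ⟨g, hgc, hg⟩ := IsExactOn.with_val_at
    (DifferentiableOn.isExactOn_ball ((hf.deriv isOpen_ball).div hf h0)) c 0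
  have hder : ∀ z ∈ ball c r, HasDerivAt (fun w ↦ f w * Complex.exp (-g w)) 0 z := fun z hz ↦ by
    have h1 := (hf.differentiableAt (isOpen_ball.mem_nhds hz)).hasDerivAt
    refine (h1.mul (hg z hz).neg.cexp).congr_deriv ?_
    simp only [Pi.div_apply]
    field_simp [h0 z hz]
    ring
  refine ⟨g, fun z hz ↦ (hg z hz).differentiableAt.differentiableWithinAt, hgc, fun z hz ↦ ?_⟩
  have h := isOpen_ball.is_const_of_deriv_eq_zero (convex_ball c r).isPreconnected
    (fun z hz ↦ (hder z hz).differentiableAt.differentiableWithinAt)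
    (fun z hz ↦ (hder z hz).deriv) hz (mem_ball_self hr)
  simp only [hgc, neg_zero, Complex.exp_zero, mul_one] at h
  rw [← h, mul_assoc, ← Complex.exp_add, neg_add_cancel, Complex.exp_zero, mul_one]

open Complex Metric Filter Topology in
/-- A holomorphic function on a disc, vanishing at the center, whose real part is at most `M` on the
disc and at most `K` on a smaller concentric disc, is `O(1) + ε M` on intermediate discs, with
`O(1)` independent of `M`. -/
theorem Complex.exists_norm_le_add_mul_of_re_le {R r ρ K ε : ℝ} (hr : 0 < r) (hrR : r < R)
    (hρ : 0 < ρ) (hρR : ρ ≤ R) (hK : 0 < K) (hε : 0 < ε) :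
    ∃ C : ℝ, ∀ (M : ℝ) (f : ℂ → ℂ), 0 < M → DifferentiableOn ℂ f (ball 0 R) → f 0 = 0 →
      (∀ z ∈ ball (0 : ℂ) R, (f z).re ≤ M) → (∀ z ∈ ball (0 : ℂ) ρ, (f z).re ≤ K) →
      ∀ z : ℂ, ‖z‖ ≤ r → ‖f z‖ ≤ C + ε * M := by
  obtain ⟨R', hrR', hR'R⟩ := exists_between hrR
  have hR' : 0 < R' := hr.trans hrR'
  have hR : 0 < R := hr.trans hrR
  set D : ℝ := 2 * R' / (R - R') with hD
  set q : ℝ := r / R' with hq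
  have hq0 : 0 ≤ q := by positivity
  have hq1 : q < 1 := (div_lt_one hR').2 hrR'
  obtain ⟨N, hN⟩ : ∃ N : ℕ, D * q ^ N * (1 - q)⁻¹ < ε := by
    have : Tendsto (fun N : ℕ ↦ D * q ^ N * (1 - q)⁻¹) atTop (𝓝 (D * 0 * (1 - q)⁻¹)) :=
      ((tendsto_pow_atTop_nhds_zero_of_lt_one hq0 hq1).const_mul D).mul_const _
    rw [mul_zero, zero_mul] at this
    exact (this.eventually (gt_mem_nhds hε)).exists
  refine ⟨∑ n ∈ Finset.range N, 2 * K * (r / (ρ / 2)) ^ n, fun M f hM hf hf0 hfM hfK z hz ↦ ?_⟩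
  have hcauchy {s B : ℝ} (hs : 0 < s) (hsR : s < R) (hB : ∀ w ∈ sphere (0 : ℂ) s, ‖f w‖ ≤ B)
      (n : ℕ) : ‖(n.factorial : ℂ)⁻¹ • (z - 0) ^ n • iteratedDeriv n f 0‖ ≤ B * (r / s) ^ n := by
    have h := norm_iteratedDeriv_le_of_forall_mem_sphere_norm_le n hs
      ((hf.mono (closedBall_subset_ball hsR)).diffContOnCl_ball subset_rfl) hB
    have hB0 : 0 ≤ B := (norm_nonneg _).trans (hB (s : ℂ) (by simp [abs_of_pos hs]))
    have hn : (0 : ℝ) < n.factorial := by positivity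
    rw [sub_zero, norm_smul, norm_smul, norm_inv, norm_natCast, norm_pow]
    calc (n.factorial : ℝ)⁻¹ * (‖z‖ ^ n * ‖iteratedDeriv n f 0‖)
        ≤ (n.factorial : ℝ)⁻¹ * (r ^ n * (n.factorial * B / s ^ n)) := by gcongr
      _ = B * (r / s) ^ n := by rw [div_pow]; field_simp
  have hbig : ∀ w ∈ sphere (0 : ℂ) R', ‖f w‖ ≤ D * M := fun w hw ↦ by
    have hw' : ‖w‖ = R' := by simpa using hw
    refine (borelCaratheodory_zero (z := w) hM hf hfM hR (by simp [hw', hR'R]) hf0).trans_eq ?_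
    rw [hw', hD]; ring
  have hsmall : ∀ w ∈ sphere (0 : ℂ) (ρ / 2), ‖f w‖ ≤ 2 * K := fun w hw ↦ by
    have hw' : ‖w‖ = ρ / 2 := by simpa using hw
    refine (borelCaratheodory_zero (z := w) hK (hf.mono (ball_subset_ball hρR)) hfK hρ
      (by simp [hw', hρ]) hf0).trans_eq ?_
    rw [hw']; field_simp; norm_num
  have hsum := hasSum_taylorSeries_on_ball hf (z := z) (by simpa using hz.trans_lt hrR)
  have htail := (hasSum_nat_add_iff' N).2 hsum
  have h1 : ‖f z - ∑ n ∈ Finset.range N,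
      (n.factorial : ℂ)⁻¹ • (z - 0) ^ n • iteratedDeriv n f 0‖ ≤ D * M * q ^ N * (1 - q)⁻¹ := by
    rw [← htail.tsum_eq]
    refine tsum_of_norm_bounded ((hasSum_geometric_of_lt_one hq0 hq1).mul_left _) fun n ↦ ?_
    refine (hcauchy hR' hR'R hbig (n + N)).trans_eq ?_
    rw [← hq]; ring
  have h2 : ‖∑ n ∈ Finset.range N, (n.factorial : ℂ)⁻¹ • (z - 0) ^ n • iteratedDeriv n f 0‖ ≤
      ∑ n ∈ Finset.range N, 2 * K * (r / (ρ / 2)) ^ n :=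
    norm_sum_le_of_le _ fun n _ ↦ hcauchy (by positivity) (by linarith) hsmall n
  have h3 : D * M * q ^ N * (1 - q)⁻¹ ≤ ε * M := by
    calc D * M * q ^ N * (1 - q)⁻¹ = D * q ^ N * (1 - q)⁻¹ * M := by ring
      _ ≤ ε * M := by gcongr
  linarith [norm_le_norm_sub_add (f z)
    (∑ n ∈ Finset.range N, (n.factorial : ℂ)⁻¹ • (z - 0) ^ n • iteratedDeriv n f 0)]

open LSeries ArithmeticFunction in
/-- On a half-plane strictly to the right of `re s = 1`, both `ζ` and `1 / ζ` are bounded. -/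
theorem riemannZeta_bounds_of_le_re {x : ℝ} (hx : 1 < x) :
    ∃ K : ℝ, ∀ s : ℂ, x ≤ s.re → ‖riemannZeta s‖ ≤ K ∧ ‖riemannZeta s‖⁻¹ ≤ K := by
  have hsum : Summable fun n ↦ ‖term 1 (x : ℂ) n‖ :=
    (LSeriesSummable_one_iff.2 (by simpa using hx)).norm
  have key (a : ℕ → ℂ) (ha : ∀ n, ‖a n‖ ≤ 1) (s : ℂ) (hs : x ≤ s.re) :
      ‖LSeries a s‖ ≤ ∑' n, ‖term 1 (x : ℂ) n‖ := by
    refine tsum_of_norm_bounded hsum.hasSum fun n ↦ ?_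
    refine (norm_term_le_of_re_le_re a (s := x) (by simpa using hs) n).trans ?_
    exact norm_term_le _ (by simpa using ha n)
  refine ⟨∑' n, ‖term 1 (x : ℂ) n‖, fun s hs ↦ ?_⟩
  have hs1 : 1 < s.re := hx.trans_le hs
  have hinv := LSeries_one_mul_Lseries_moebius hs1
  refine ⟨LSeries_one_eq_riemannZeta hs1 ▸ key 1 (by simp) s hs, ?_⟩
  rw [← norm_inv, ← LSeries_one_eq_riemannZeta hs1, inv_eq_of_mul_eq_one_right hinv]
  refine key _ (fun n ↦ ?_) s hs
  simpa using mod_cast abs_moebius_le_one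

open Complex in
/-- The `n`-th Euler–Maclaurin term of `(s - 1) * ζ(s)` is small. -/
theorem norm_cpow_add_one_sub_cpow_add_le {x : ℝ} (hx : 0 < x) {s : ℂ} (hs : 0 ≤ s.re) :
    ‖((x + 1 : ℝ) : ℂ) ^ (1 - s) - (x : ℂ) ^ (1 - s) + (s - 1) * (x : ℂ) ^ (-s)‖ ≤
      ‖s - 1‖ * ‖s‖ * x ^ (-s.re - 1) := by
  have hcpow (w : ℂ) {y : ℝ} (hy : 0 < y) :
      HasDerivAt (fun y : ℝ ↦ (y : ℂ) ^ w) (w * (y : ℂ) ^ (w - 1)) y := by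
    have h : HasDerivAt (fun z : ℂ ↦ z ^ w) (w * (y : ℂ) ^ (w - 1)) y := by
      simpa using (hasDerivAt_id (y : ℂ)).cpow_const (c := w) (by simp [hy])
    exact h.comp_ofReal
  have hone {y : ℝ} (hy : y ∈ Set.Icc x (x + 1)) :
      ‖(y : ℂ) ^ (-s) - (x : ℂ) ^ (-s)‖ ≤ ‖s‖ * x ^ (-s.re - 1) := by
    have h := (convex_Icc x (x + 1)).norm_image_sub_le_of_norm_hasDerivWithin_le
      (f := fun y : ℝ ↦ (y : ℂ) ^ (-s)) (f' := fun y : ℝ ↦ -s * (y : ℂ) ^ (-s - 1))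
      (C := ‖s‖ * x ^ (-s.re - 1)) (fun u hu ↦ (hcpow (-s) (hx.trans_le hu.1)).hasDerivWithinAt)
      (fun u hu ↦ ?_) (Set.left_mem_Icc.2 (by linarith)) hy
    · refine h.trans (mul_le_of_le_one_right (by positivity) ?_)
      rw [Real.norm_eq_abs, abs_le]
      constructor <;> linarith [hy.1, hy.2]
    · rw [norm_mul, norm_neg, norm_cpow_eq_rpow_re_of_pos (hx.trans_le hu.1)]
      simp only [sub_re, neg_re, one_re]
      gcongr ?_ * ?_
      exact Real.rpow_le_rpow_of_nonpos hx hu.1 (by linarith)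
  have h := (convex_Icc x (x + 1)).norm_image_sub_le_of_norm_hasDerivWithin_le
    (f := fun y : ℝ ↦ (y : ℂ) ^ (1 - s) + (s - 1) * (x : ℂ) ^ (-s) * (y : ℂ))
    (f' := fun y : ℝ ↦ (1 - s) * ((y : ℂ) ^ (-s) - (x : ℂ) ^ (-s)))
    (C := ‖s - 1‖ * ‖s‖ * x ^ (-s.re - 1)) (fun u hu ↦ ?_) (fun u hu ↦ ?_)
    (Set.left_mem_Icc.2 (by linarith)) (Set.right_mem_Icc.2 (by linarith : x ≤ x + 1))
  · convert h using 1
    · congr 1; push_cast; ring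
    · simp
  · have h1 := hcpow (1 - s) (hx.trans_le hu.1)
    have h2 : HasDerivAt (fun y : ℝ ↦ (s - 1) * (x : ℂ) ^ (-s) * (y : ℂ))
        ((s - 1) * (x : ℂ) ^ (-s) * 1) u := ((hasDerivAt_id u).ofReal_comp).const_mul _
    refine ((h1.add h2).congr_deriv ?_).hasDerivWithinAt
    rw [show 1 - s - 1 = -s by ring]; ring
  · rw [norm_mul, norm_sub_rev, mul_assoc]
    gcongr
    exact hone hu

open Complex Filter Topology in
/-- A series for `(s - 1) * ζ(s) - 1`, whose terms are `O(‖s‖ ^ 2 * n ^ (-re s - 1))`. -/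
theorem hasSum_riemannZeta₁_sub_one {s : ℂ} (hs : 1 < s.re) :
    HasSum (fun n : ℕ ↦ (((n + 1 : ℝ) + 1 : ℝ) : ℂ) ^ (1 - s) - ((n + 1 : ℝ) : ℂ) ^ (1 - s)
      + (s - 1) * ((n + 1 : ℝ) : ℂ) ^ (-s)) (riemannZeta₁ s - 1) := by
  have hs1 : s ≠ 1 := by rintro rfl; simp at hs
  have hzeta : HasSum (fun n : ℕ ↦ ((n + 1 : ℝ) : ℂ) ^ (-s)) (riemannZeta s) := by
    rw [zeta_eq_tsum_one_div_nat_add_one_cpow hs]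
    have := ((summable_nat_add_iff 1).2 (summable_one_div_nat_cpow.2 hs)).hasSum
    push_cast at this ⊢
    simpa [cpow_neg] using this
  have hlim : Tendsto (fun n : ℕ ↦ ((n + 1 : ℝ) : ℂ) ^ (1 - s)) atTop (𝓝 0) := by
    rw [tendsto_zero_iff_norm_tendsto_zero]
    have h := (tendsto_rpow_neg_atTop (sub_pos.2 hs)).comp
      (tendsto_natCast_atTop_atTop.atTop_add (tendsto_const_nhds (x := (1 : ℝ))))
    refine h.congr fun n ↦ ?_
    rw [norm_cpow_eq_rpow_re_of_pos (by positivity)]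
    simp
  have hsummable : Summable (fun n : ℕ ↦
      (((n + 1 : ℝ) + 1 : ℝ) : ℂ) ^ (1 - s) - ((n + 1 : ℝ) : ℂ) ^ (1 - s)
      + (s - 1) * ((n + 1 : ℝ) : ℂ) ^ (-s)) := by
    refine Summable.of_norm_bounded (g := fun n : ℕ ↦ ‖s - 1‖ * ‖s‖ * ((n + 1 : ℕ) : ℝ) ^ (-s.re - 1))
      (((summable_nat_add_iff 1).2 (Real.summable_nat_rpow.2 (by linarith))).mul_left _) fun n ↦ ?_
    exact_mod_cast norm_cpow_add_one_sub_cpow_add_le (x := n + 1) (by positivity) (by linarith)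
  convert hsummable.hasSum using 1
  refine tendsto_nhds_unique ?_ hsummable.hasSum.tendsto_sum_nat
  have h := (hlim.sub_const 1).add
    (hzeta.tendsto_sum_nat.const_mul (s - 1))
  have hval : 0 - 1 + (s - 1) * riemannZeta s = riemannZeta₁ s - 1 := by
    rw [riemannZeta_eq_inv_sub_mul hs1, mul_inv_cancel_left₀ (sub_ne_zero.2 hs1)]; ring
  rw [hval] at h
  refine h.congr fun N ↦ ?_
  rw [Finset.sum_add_distrib, Finset.mul_sum]
  congr 1
  have := Finset.sum_range_sub (fun n : ℕ ↦ ((n + 1 : ℝ) : ℂ) ^ (1 - s)) N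
  push_cast at this ⊢
  simp [this]

open Complex Filter Topology in
theorem norm_riemannZeta₁_le {s : ℂ} (hs : 1 / 2 < s.re) :
    ‖riemannZeta₁ s‖ ≤ 1 + ‖s - 1‖ * ‖s‖ * ∑' n : ℕ, ((n + 1 : ℕ) : ℝ) ^ (-(3 / 2) : ℝ) := by
  set F : ℕ → ℂ → ℂ := fun n w ↦ (((n + 1 : ℝ) + 1 : ℝ) : ℂ) ^ (1 - w)
    - ((n + 1 : ℝ) : ℂ) ^ (1 - w) + (w - 1) * ((n + 1 : ℝ) : ℂ) ^ (-w) with hF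
  have hsum : Summable fun n : ℕ ↦ ((n + 1 : ℕ) : ℝ) ^ (-(3 / 2) : ℝ) :=
    (summable_nat_add_iff 1).2 (Real.summable_nat_rpow.2 (by norm_num))
  have hFle (n : ℕ) {w : ℂ} (hw : 1 / 2 < w.re) :
      ‖F n w‖ ≤ ‖w - 1‖ * ‖w‖ * ((n + 1 : ℕ) : ℝ) ^ (-(3 / 2) : ℝ) := by
    have h := norm_cpow_add_one_sub_cpow_add_le (x := n + 1) (by positivity)
      (show 0 ≤ w.re by linarith)
    refine h.trans ?_
    push_cast
    gcongr
    · linarith [n.cast_nonneg (α := ℝ)]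
    · linarith
  set U : Set ℂ := {w | 1 / 2 < w.re} ∩ Metric.ball 0 (‖s‖ + 3) with hU
  have hUo : IsOpen U := (isOpen_lt continuous_const continuous_re).inter Metric.isOpen_ball
  have hUc : Convex ℝ U := (convex_halfSpace_re_gt _).inter (convex_ball _ _)
  have hsU : s ∈ U := ⟨hs, by simp⟩
  have h2U : (2 : ℂ) ∈ U := ⟨by norm_num, by
    simp only [mem_ball_zero_iff, norm_ofNat]; linarith [norm_nonneg s]⟩
  have hd : DifferentiableOn ℂ (fun w ↦ ∑' n, F n w) U := by
    refine differentiableOn_tsum_of_summable_norm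
      (hsum.mul_left ((‖s‖ + 4) * (‖s‖ + 3))) (fun n ↦ ?_) hUo (fun n w hw ↦ ?_)
    · have h1 : ((n + 1 : ℝ) : ℂ) ≠ 0 := by exact_mod_cast n.succ_ne_zero
      have h2 : (((n + 1 : ℝ) + 1 : ℝ) : ℂ) ≠ 0 := by exact_mod_cast (n + 1).succ_ne_zero
      refine Differentiable.differentiableOn ?_
      refine Differentiable.add (Differentiable.sub ?_ ?_) (Differentiable.mul (by fun_prop) ?_)
      · exact (differentiable_id.const_sub 1).const_cpow (.inl h2)
      · exact (differentiable_id.const_sub 1).const_cpow (.inl h1)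
      · exact differentiable_id.neg.const_cpow (.inl h1)
    · have hw2 : ‖w‖ < ‖s‖ + 3 := by simpa using hw.2
      have hw3 : ‖w - 1‖ ≤ ‖s‖ + 4 := (norm_sub_le _ _).trans (by simp; linarith)
      refine (hFle n hw.1).trans ?_
      gcongr
  have hev : (fun w ↦ ∑' n, F n w) =ᶠ[𝓝 2] fun w ↦ riemannZeta₁ w - 1 := by
    filter_upwards [(isOpen_lt continuous_const continuous_re).mem_nhds
      (show (1 : ℝ) < (2 : ℂ).re by norm_num)] with w hw
    exact (hasSum_riemannZeta₁_sub_one hw).tsum_eq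
  have heq := (hd.analyticOnNhd hUo).eqOn_of_preconnected_of_eventuallyEq
    ((differentiable_riemannZeta₁.sub_const 1).differentiableOn.analyticOnNhd hUo)
    hUc.isPreconnected h2U hev hsU
  have hle : ‖riemannZeta₁ s - 1‖ ≤
      ‖s - 1‖ * ‖s‖ * ∑' n : ℕ, ((n + 1 : ℕ) : ℝ) ^ (-(3 / 2) : ℝ) := by
    rw [← show ∑' n, F n s = riemannZeta₁ s - 1 from heq]
    exact tsum_of_norm_bounded (hsum.hasSum.mul_left _) fun n ↦ hFle n hs
  have := norm_le_norm_sub_add (riemannZeta₁ s) 1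
  rw [norm_one] at this
  linarith

/-- `ζ` grows at most linearly to the right of the critical line. -/
theorem exists_norm_riemannZeta_le_mul_norm :
    ∃ B : ℝ, ∀ s : ℂ, 1 / 2 < s.re → 1 ≤ |s.im| → ‖riemannZeta s‖ ≤ B * ‖s‖ := by
  refine ⟨1 + ∑' n : ℕ, ((n + 1 : ℕ) : ℝ) ^ (-(3 / 2) : ℝ), fun s hs him ↦ ?_⟩
  have hs1 : 1 ≤ ‖s - 1‖ := him.trans (by simpa using Complex.abs_im_le_norm (s - 1))
  have hs0 : 1 ≤ ‖s‖ := him.trans (Complex.abs_im_le_norm s)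
  have hne : s ≠ 1 := by rintro rfl; simp at hs1; linarith
  rw [riemannZeta_eq_inv_sub_mul hne, norm_mul, norm_inv, inv_mul_le_iff₀ (by linarith)]
  refine (norm_riemannZeta₁_le hs).trans ?_
  nlinarith [mul_le_mul hs1 hs0 zero_le_one (by linarith)]

open Complex Metric in
/-- Under the Riemann hypothesis, `log ‖ζ(σ + it)‖ = o(log |t|)` uniformly on `σ ≥ σ₀ > 1 / 2`. -/
theorem RiemannHypothesis.exists_abs_log_norm_riemannZeta_le (hRH : RiemannHypothesis)
    {σ₀ ε : ℝ} (hσ₀ : σ₀ ∈ Set.Ioo (1 / 2 : ℝ) 1) (hε : 0 < ε) :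
    ∃ C : ℝ, ∀ σ t : ℝ, σ₀ ≤ σ → 3 ≤ |t| → riemannZeta (σ + t * I) ≠ 0 ∧
      |Real.log ‖riemannZeta (σ + t * I)‖| ≤ C + ε * Real.log (1 + |t|) := by
  obtain ⟨B₀, hB₀⟩ := exists_norm_riemannZeta_le_mul_norm
  obtain ⟨K₀, hK₀⟩ := riemannZeta_bounds_of_le_re (x := 3 / 2) (by norm_num)
  set B := max B₀ 1
  set K := max K₀ 1
  have hB1 : 1 ≤ B := le_max_right _ _
  have hK1 : 1 ≤ K := le_max_right _ _
  have hB (s : ℂ) (hs : 1 / 2 < s.re) (him : 1 ≤ |s.im|) : ‖riemannZeta s‖ ≤ B * ‖s‖ :=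
    (hB₀ s hs him).trans (by gcongr; exact le_max_left _ _)
  have hK (s : ℂ) (hs : 3 / 2 ≤ s.re) : ‖riemannZeta s‖ ≤ K ∧ ‖riemannZeta s‖⁻¹ ≤ K :=
    ⟨(hK₀ s hs).1.trans (le_max_left _ _), (hK₀ s hs).2.trans (le_max_left _ _)⟩
  have hne (s : ℂ) (hs : 1 / 2 < s.re) (him : 1 ≤ |s.im|) : riemannZeta s ≠ 0 := fun h0 ↦ by
    refine hs.ne' (hRH s h0 ?_ ?_)
    · rintro ⟨n, rfl⟩
      norm_num at him
    · rintro rfl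
      norm_num at him
  have hlogK : 0 ≤ Real.log K := Real.log_nonneg hK1
  have hlogBK : 0 ≤ Real.log (4 * B * K) := Real.log_nonneg (by nlinarith)
  have hlog (s : ℂ) (hs : 3 / 2 ≤ s.re) (h0 : riemannZeta s ≠ 0) :
      |Real.log ‖riemannZeta s‖| ≤ Real.log K := by
    have hpos := norm_pos_iff.2 h0
    rw [abs_le', ← Real.log_inv]
    exact ⟨Real.log_le_log hpos (hK s hs).1, Real.log_le_log (inv_pos.2 hpos) (hK s hs).2⟩
  obtain ⟨C, hC⟩ := Complex.exists_norm_le_add_mul_of_re_le (R := 3 / 2) (r := 2 - σ₀) (ρ := 1 / 2)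
    (K := Real.log (K * K) + 1) (ε := ε) (by linarith [hσ₀.2]) (by linarith [hσ₀.1])
    (by norm_num) (by norm_num) (by linarith [Real.log_nonneg (show 1 ≤ K * K by nlinarith)]) hε
  refine ⟨Real.log K + max C 0 + ε * Real.log (4 * B * K), fun σ t hσ ht ↦ ?_⟩
  have hlogt : 0 < Real.log (1 + |t|) := Real.log_pos (by linarith)
  have h0 : riemannZeta (σ + t * I) ≠ 0 :=
    hne _ (by simpa using hσ₀.1.trans_le hσ) (by simpa using by linarith)
  refine ⟨h0, ?_⟩
  rcases le_total 2 σ with h2 | h2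
  · refine (hlog _ (by simp; linarith) h0).trans ?_
    have := mul_nonneg hε.le hlogBK
    have := mul_nonneg hε.le hlogt.le
    linarith [le_max_right C 0]
  set c : ℂ := 2 + t * I with hc
  have hre (w : ℂ) : (c + w).re = 2 + w.re := by simp [hc]
  have him (w : ℂ) : (c + w).im = t + w.im := by simp [hc]
  have hball {w : ℂ} (hw : w ∈ ball (0 : ℂ) (3 / 2)) :
      1 / 2 < (c + w).re ∧ 1 ≤ |(c + w).im| := by
    rw [mem_ball_zero_iff] at hw
    rw [hre, him]
    have h1 := (abs_le.1 (abs_re_le_norm w)).1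
    have h2 := abs_im_le_norm w
    have h3 := abs_sub_abs_le_abs_sub t (-w.im)
    rw [abs_neg, sub_neg_eq_add] at h3
    constructor <;> linarith
  have hdiff : DifferentiableOn ℂ (fun w ↦ riemannZeta (c + w)) (ball 0 (3 / 2)) := fun w hw ↦ by
    have h1 : c + w ≠ 1 := fun h ↦ by
      have := (hball hw).2
      rw [h] at this
      norm_num at this
    exact ((differentiableAt_riemannZeta h1).comp w
      (differentiableAt_id.const_add c)).differentiableWithinAt
  obtain ⟨g, hg, hg0, hgexp⟩ := hdiff.exists_eq_mul_exp (by norm_num)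
    fun w hw ↦ hne _ (hball hw).1 (hball hw).2
  simp only [add_zero] at hgexp
  have hc0 : riemannZeta c ≠ 0 := by
    simpa using hne (c + 0) (hball (by simp)).1 (hball (by simp)).2
  have hcK := hK c (by simp [hc]; norm_num)
  have hgre {w : ℂ} (hw : w ∈ ball (0 : ℂ) (3 / 2)) :
      Real.exp (g w).re = ‖riemannZeta (c + w)‖ * ‖riemannZeta c‖⁻¹ := by
    rw [hgexp w hw, norm_mul, norm_exp]
    field_simp [norm_ne_zero_iff.2 hc0]
  have hbound := hC (Real.log (4 * B * K) + Real.log (1 + |t|)) g (by linarith) hg hg0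
    (fun w hw ↦ ?_) (fun w hw ↦ ?_) (σ - 2 : ℝ) ?_
  · have hmem : ((σ - 2 : ℝ) : ℂ) ∈ ball (0 : ℂ) (3 / 2) := by
      rw [mem_ball_zero_iff, norm_real, Real.norm_eq_abs, abs_lt]
      constructor <;> linarith [hσ₀.1]
    have hs : (σ + t * I : ℂ) = c + (σ - 2 : ℝ) := by rw [hc]; push_cast; ring
    rw [hs, hgexp _ hmem, norm_mul, norm_exp, Real.log_mul (norm_ne_zero_iff.2 hc0)
      (Real.exp_ne_zero _), Real.log_exp]
    have h1 := hlog c (by simp [hc]; norm_num) hc0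
    have h2 := abs_re_le_norm (g (σ - 2 : ℝ))
    have h3 := abs_add_le (Real.log ‖riemannZeta c‖) (g (σ - 2 : ℝ)).re
    linarith [le_max_left C 0]
  · have hw' : ‖w‖ < 3 / 2 := by simpa using hw
    rw [← Real.log_mul (by positivity) (by positivity), Real.le_log_iff_exp_le (by positivity),
      hgre hw]
    have hnorm : ‖c + w‖ ≤ 4 * (1 + |t|) := by
      have h1 : ‖c‖ ≤ 2 + |t| := (norm_add_le _ _).trans (by simp)
      linarith [norm_add_le c w]
    calc ‖riemannZeta (c + w)‖ * ‖riemannZeta c‖⁻¹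
        ≤ (B * (4 * (1 + |t|))) * K := by
          gcongr
          · exact (hB _ (hball hw).1 (hball hw).2).trans (by gcongr)
          · exact hcK.2
      _ = 4 * B * K * (1 + |t|) := by ring
  · have hw' : ‖w‖ < 1 / 2 := by simpa using hw
    have hwre := (abs_le.1 (abs_re_le_norm w)).1
    refine le_add_of_le_of_nonneg ?_ zero_le_one
    rw [Real.le_log_iff_exp_le (by positivity), hgre (ball_subset_ball (by norm_num) hw)]
    gcongr
    · exact (hK _ (by rw [hre]; linarith)).1
    · exact hcK.2
  · rw [norm_real, Real.norm_eq_abs, abs_le]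
    constructor <;> linarith


/-- Under RH, for fixed `σ₀ ∈ (1/2,1)` and `A > 0`: for every
`ε > 0` there is `C > 0` with `|ζ(σ+it)|^a ≤ C(1+|t|)^ε` uniformly for `σ ≥ σ₀`,
`|t| ≥ 3` and real `|a| ≤ A`; in particular both `|ζ(σ+it)|` and `|ζ(σ+it)|⁻¹` are
`≤ C(1+|t|)^ε` in this region. -/
theorem zeta_power_bound_right_of_critical_line
    (hRH : RiemannHypothesis)
    (σ₀ : ℝ) (hσ₀ : σ₀ ∈ Set.Ioo (1 / 2 : ℝ) 1) (A : ℝ) (hA : 0 < A)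
    (ε : ℝ) (hε : 0 < ε) :
    ∃ C : ℝ, 0 < C ∧
      (∀ σ t a : ℝ, σ₀ ≤ σ → 3 ≤ |t| → |a| ≤ A →
        ‖riemannZeta ((σ : ℂ) + (t : ℂ) * Complex.I)‖ ^ a ≤ C * (1 + |t|) ^ ε) ∧
      (∀ σ t : ℝ, σ₀ ≤ σ → 3 ≤ |t| →
        ‖riemannZeta ((σ : ℂ) + (t : ℂ) * Complex.I)‖ ≤ C * (1 + |t|) ^ ε ∧
        ‖riemannZeta ((σ : ℂ) + (t : ℂ) * Complex.I)‖⁻¹ ≤ C * (1 + |t|) ^ ε) := by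
  obtain ⟨C, hC⟩ := hRH.exists_abs_log_norm_riemannZeta_le hσ₀
    (show 0 < ε / max A 1 by positivity)
  have key (σ t a : ℝ) (hσ : σ₀ ≤ σ) (ht : 3 ≤ |t|) (ha : |a| ≤ max A 1) :
      ‖riemannZeta ((σ : ℂ) + (t : ℂ) * Complex.I)‖ ^ a ≤
        Real.exp (max A 1 * C) * (1 + |t|) ^ ε := by
    obtain ⟨h0, hle⟩ := hC σ t hσ ht
    rw [Real.rpow_def_of_pos (norm_pos_iff.2 h0), Real.rpow_def_of_pos (by positivity),
      ← Real.exp_add, Real.exp_le_exp]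
    refine (le_abs_self _).trans ?_
    rw [abs_mul, mul_comm]
    calc |a| * |Real.log ‖riemannZeta ((σ : ℂ) + (t : ℂ) * Complex.I)‖|
        ≤ max A 1 * (C + ε / max A 1 * Real.log (1 + |t|)) := by gcongr
      _ = max A 1 * C + Real.log (1 + |t|) * ε := by field_simp
  refine ⟨Real.exp (max A 1 * C), Real.exp_pos _,
    fun σ t a hσ ht ha ↦ key σ t a hσ ht (ha.trans (le_max_left _ _)), fun σ t hσ ht ↦ ⟨?_, ?_⟩⟩
  · simpa using key σ t 1 hσ ht (by simp)
  · simpa [Real.rpow_neg_one] using key σ t (-1) hσ ht (by simp)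
end
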